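/- Let s ∈ ℂ be such that q_s(0) = Σ_{k=0}^N φ^{(N−k)}(0) s^k ≠ 0. Then there exists a unique complex polynomial r of degree at most N satisfying r(0) = 1 and r′ = s·T_{N−1} r, and it is given explicitly by r(θ) = (Σ_{k=0}^N φ^{(N−k)}(θ) s^k)/(Σ_{k=0}^N φ^{(N−k)}(0) s^k). -/

import Mathlib

open Polynomial MeasureTheory

namespace Polynomial

/-- A nonzero polynomial cannot be an eigenvector of `derivative` with nonzero eigenvalue. -/
theorem eq_zero_of_derivative_eq_C_mul {R : Type*} [CommRing R] [IsDomain R] {s : R} (hs : s ≠ 0)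
    {p : R[X]} (hp : derivative p = C s * p) : p = 0 := by
  by_contra h
  have hlt := degree_derivative_lt h
  rw [hp, degree_C_mul hs] at hlt
  exact lt_irrefl _ hlt

theorem derivative_sum_C_pow_mul_iterate_derivative {R : Type*} [CommRing R] (N : ℕ) {p : R[X]}
    (hp : p.natDegree ≤ N) (s : R) :
    derivative (∑ k ∈ Finset.range (N + 1), C (s ^ k) * derivative^[N - k] p) =
      C s * (∑ k ∈ Finset.range (N + 1), C (s ^ k) * derivative^[N - k] p - C (s ^ N) * p) := by
  have hzero : derivative^[N + 1] p = 0 := iterate_derivative_eq_zero (by lia)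
  have hlow : ∑ k ∈ Finset.range (N + 1), C (s ^ k) * derivative^[N - k] p - C (s ^ N) * p =
      ∑ k ∈ Finset.range N, C (s ^ k) * derivative^[N - k] p := by
    simp [Finset.sum_range_succ]
  rw [hlow, Finset.sum_range_succ']
  simp only [derivative_add, derivative_sum, derivative_C_mul, Nat.sub_zero,
    ← Function.iterate_succ_apply' (derivative (R := R)), Nat.succ_eq_add_one, hzero, mul_zero,
    add_zero, Finset.mul_sum]
  refine Finset.sum_congr rfl fun k hk => ?_
  rw [Finset.mem_range] at hk
  rw [show N - (k + 1) + 1 = N - k by lia, pow_succ', C_mul, mul_assoc]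

end Polynomial

/-- Pairing with `φ`, orthogonal to all lower-degree polynomials, picks out the top term `k = N`. -/
theorem integral_sum_iterate_derivative_mul (a b : ℝ) (N : ℕ) (w : ℝ → ℝ)
    (hint : ∀ g : ℝ[X], IntervalIntegrable (fun θ => g.eval θ * w θ) volume a b)
    (φ : ℝ[X]) (hφdeg : φ.natDegree ≤ N)
    (horth : ∀ g : ℝ[X], g.natDegree < N → ∫ θ in a..b, g.eval θ * φ.eval θ * w θ = 0)
    (s : ℂ) :
    ∫ θ in a..b, (∑ k ∈ Finset.range (N + 1),
        C (s ^ k) * (derivative^[N - k] φ).map (algebraMap ℝ ℂ)).eval (θ : ℂ) *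
          ((φ.eval θ : ℝ) : ℂ) * ((w θ : ℝ) : ℂ) =
      s ^ N * ((∫ θ in a..b, φ.eval θ ^ 2 * w θ : ℝ) : ℂ) := by
  have heval (g : ℝ[X]) (θ : ℝ) :
      (g.map (algebraMap ℝ ℂ)).eval (θ : ℂ) = ((g.eval θ : ℝ) : ℂ) :=
    eval_map_apply (algebraMap ℝ ℂ) θ
  have hintegrand (θ : ℝ) : (∑ k ∈ Finset.range (N + 1),
        C (s ^ k) * (derivative^[N - k] φ).map (algebraMap ℝ ℂ)).eval (θ : ℂ) *
          ((φ.eval θ : ℝ) : ℂ) * ((w θ : ℝ) : ℂ) =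
      ∑ k ∈ Finset.range (N + 1),
        s ^ k * (((derivative^[N - k] φ).eval θ * φ.eval θ * w θ : ℝ) : ℂ) := by
    simp only [eval_finsetSum, eval_mul, eval_C, heval, Finset.sum_mul, Complex.ofReal_mul,
      mul_assoc]
  simp only [hintegrand]
  rw [intervalIntegral.integral_finsetSum]
  · simp only [intervalIntegral.integral_const_mul, intervalIntegral.integral_ofReal]
    rw [Finset.sum_range_succ, Finset.sum_eq_zero, zero_add]
    · simp [sq]
    · intro k hk
      rw [Finset.mem_range] at hk
      have hdeg := natDegree_iterate_derivative φ (N - k)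
      by_cases h : (derivative^[N - k] φ).natDegree < N
      · rw [horth _ h, Complex.ofReal_zero, mul_zero]
      · lia
  · intro k _
    have hprod := hint (derivative^[N - k] φ * φ)
    simp only [eval_mul] at hprod
    exact IntervalIntegrable.const_mul ⟨hprod.1.ofReal, hprod.2.ofReal⟩ _

/-- With `φ` a real polynomial of degree exactly `N ≥ 1`, orthogonal to all
polynomials of degree `< N` w.r.t. the weight `w` on `[-τ, 0]`, positive norm, and
`s : ℂ` such that `q_s(0) = ∑_{k=0}^N φ^{(N-k)}(0) s^k ≠ 0`: a complex polynomial `r` of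
degree at most `N` satisfies `r(0) = 1` and `r' = s·T_{N-1} r` if and only if
`r = q_s / q_s(0)`; in particular such an `r` exists and is unique. -/
theorem tau_rational_approximant (τ : ℝ) (hτ : 0 < τ) (N : ℕ) (hN : 1 ≤ N)
    (w : ℝ → ℝ) (hw : ∀ θ ∈ Set.Icc (-τ) 0, 0 ≤ w θ)
    (hint : ∀ g : Polynomial ℝ,
      IntervalIntegrable (fun θ => g.eval θ * w θ) volume (-τ) 0)
    (φ : Polynomial ℝ) (hφdeg : φ.natDegree = N)
    (horth : ∀ g : Polynomial ℝ, g.natDegree < N →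
      ∫ θ in (-τ)..0, g.eval θ * φ.eval θ * w θ = 0)
    (hnorm : 0 < ∫ θ in (-τ)..0, φ.eval θ ^ 2 * w θ)
    (s : ℂ)
    (hden : (∑ k ∈ Finset.range (N + 1),
        C (s ^ k) * (derivative^[N - k] φ).map (algebraMap ℝ ℂ)).eval 0 ≠ 0) :
    ∀ r : Polynomial ℂ,
      (r.natDegree ≤ N ∧ r.eval 0 = 1 ∧
        derivative r = C s *
          (r - C ((∫ θ in (-τ)..0, r.eval ((θ : ℝ) : ℂ) * ((φ.eval θ : ℝ) : ℂ) * ((w θ : ℝ) : ℂ)) /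
              ((∫ θ in (-τ)..0, φ.eval θ ^ 2 * w θ : ℝ) : ℂ)) * φ.map (algebraMap ℝ ℂ)))
      ↔ r = C ((∑ k ∈ Finset.range (N + 1),
            C (s ^ k) * (derivative^[N - k] φ).map (algebraMap ℝ ℂ)).eval 0)⁻¹ *
          ∑ k ∈ Finset.range (N + 1), C (s ^ k) * (derivative^[N - k] φ).map (algebraMap ℝ ℂ) := by
  have hder : derivative (∑ k ∈ Finset.range (N + 1),
        C (s ^ k) * (derivative^[N - k] φ).map (algebraMap ℝ ℂ)) =
      C s * (∑ k ∈ Finset.range (N + 1),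
        C (s ^ k) * (derivative^[N - k] φ).map (algebraMap ℝ ℂ) -
          C (s ^ N) * φ.map (algebraMap ℝ ℂ)) := by
    simp only [← iterate_derivative_map]
    exact derivative_sum_C_pow_mul_iterate_derivative N (natDegree_map_le.trans hφdeg.le) s
  have hpair := integral_sum_iterate_derivative_mul (-τ) 0 N w hint φ hφdeg.le horth s
  have hdeg : (∑ k ∈ Finset.range (N + 1),
      C (s ^ k) * (derivative^[N - k] φ).map (algebraMap ℝ ℂ)).natDegree ≤ N := by
    refine natDegree_sum_le_of_forall_le _ _ fun k _ => (natDegree_C_mul_le _ _).trans ?_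
    exact natDegree_map_le.trans ((natDegree_iterate_derivative φ _).trans (by lia))
  have hnorm' : ((∫ θ in (-τ)..0, φ.eval θ ^ 2 * w θ : ℝ) : ℂ) ≠ 0 :=
    Complex.ofReal_ne_zero.mpr hnorm.ne'
  set q := ∑ k ∈ Finset.range (N + 1), C (s ^ k) * (derivative^[N - k] φ).map (algebraMap ℝ ℂ)
  intro r
  constructor
  · rintro ⟨-, hr0, hr⟩
    generalize (∫ θ in (-τ)..0, r.eval ((θ : ℝ) : ℂ) * ((φ.eval θ : ℝ) : ℂ) * ((w θ : ℝ) : ℂ)) /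
      ((∫ θ in (-τ)..0, φ.eval θ ^ 2 * w θ : ℝ) : ℂ) = c at hr
    suffices h : r * C (q.eval 0) = q by
      rw [← h, mul_left_comm, eval_mul, eval_C, hr0, one_mul, ← C_mul, inv_mul_cancel₀ hden,
        C_1, mul_one]
    by_cases hs : s = 0
    · rw [hs, C_0, zero_mul] at hr hder
      rw [eq_C_of_derivative_eq_zero hder, eq_C_of_derivative_eq_zero hr,
        coeff_zero_eq_eval_zero, coeff_zero_eq_eval_zero, hr0, eval_C, C_1, one_mul]
    · have hsN : s ^ N ≠ 0 := pow_ne_zero N hs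
      have hzero : C (s ^ N) * r - C c * q = 0 := by
        apply eq_zero_of_derivative_eq_C_mul hs
        rw [derivative_sub, derivative_C_mul, derivative_C_mul, hr, hder]
        ring
      have hc : s ^ N = c * q.eval 0 := by
        simpa [hr0, sub_eq_zero] using congrArg (eval 0) hzero
      have hc0 : c ≠ 0 := by
        rintro rfl
        exact hsN (by simpa using hc)
      apply mul_left_cancel₀ (C_ne_zero.mpr hc0)
      rw [hc, C_mul] at hzero
      linear_combination hzero
  · rintro rfl
    refine ⟨(natDegree_C_mul_le _ _).trans hdeg, by simp [hden], ?_⟩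
    have hcoef : (∫ θ in (-τ)..0, (C (q.eval 0)⁻¹ * q).eval ((θ : ℝ) : ℂ) *
          ((φ.eval θ : ℝ) : ℂ) * ((w θ : ℝ) : ℂ)) /
        ((∫ θ in (-τ)..0, φ.eval θ ^ 2 * w θ : ℝ) : ℂ) = (q.eval 0)⁻¹ * s ^ N := by
      simp only [eval_mul, eval_C, mul_assoc] at hpair ⊢
      rw [intervalIntegral.integral_const_mul, hpair, mul_div_assoc,
        mul_div_cancel_right₀ _ hnorm']
    rw [hcoef, derivative_C_mul, hder, C_mul]
    ring
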